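/- Let A = {1,…,k} with k ≥ 2 and A' = {1,…,k+1}. For a gate F over A, let PF be the gate over A' that fixes any input containing the symbol k+1 and acts as F otherwise; for a gate class S over A, let PS = ⟨PF : F ∈ S⟩. Then for any reversible gate F over A and any gate class S over A, if PF ∈ PS then F ∈ S. -/

import Mathlib

/-- A reversible gate function of arity `n` over alphabet `A`: a bijection `A^n → A^n`. -/
abbrev GateFun (A : Type*) (n : ℕ) := (Fin n → A) ≃ (Fin n → A)

/-- A reversible gate over alphabet `A`: an arity together with a bijection of that arity. -/
abbrev Gate (A : Type*) := Σ n : ℕ, GateFun A n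

/-- The canonical identification `A^{n+m} ≃ A^n × A^m`. -/
def splitEquiv (A : Type*) (n m : ℕ) :
    (Fin (n + m) → A) ≃ ((Fin n → A) × (Fin m → A)) :=
  (Equiv.arrowCongr finSumFinEquiv.symm (Equiv.refl A)).trans
    (Equiv.sumArrowEquivProdArrow _ _ A)

/-- The permutation gate `P_σ`, mapping `(a_1,…,a_n)` to `(a_{σ(1)},…,a_{σ(n)})`. -/
def permGate (A : Type*) {n : ℕ} (σ : Equiv.Perm (Fin n)) : GateFun A n :=
  Equiv.arrowCongr σ.symm (Equiv.refl A)

/-- Tensor product of gates. -/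
def tensorGate {A : Type*} {n m : ℕ} (F : GateFun A n) (G : GateFun A m) :
    GateFun A (n + m) :=
  ((splitEquiv A n m).trans (F.prodCongr G)).trans (splitEquiv A n m).symm

/-- The generation relation: `Generates S g` means `g` can be generated from the set `S`
of reversible gates using the permutation, tensor product, composition and ancilla rules. -/
inductive Generates {A : Type*} (S : Set (Gate A)) : Gate A → Prop
  | mem {g : Gate A} : g ∈ S → Generates S g
  | perm (n : ℕ) (σ : Equiv.Perm (Fin n)) : Generates S ⟨n, permGate A σ⟩
  | tensor {n m : ℕ} {F : GateFun A n} {G : GateFun A m} :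
      Generates S ⟨n, F⟩ → Generates S ⟨m, G⟩ → Generates S ⟨n + m, tensorGate F G⟩
  | comp {n : ℕ} {F G : GateFun A n} :
      Generates S ⟨n, F⟩ → Generates S ⟨n, G⟩ → Generates S ⟨n, G.trans F⟩
  | ancilla {l m : ℕ} {F : GateFun A (l + m)} (a : Fin l → A) {F' : GateFun A m} :
      Generates S ⟨l + m, F⟩ →
      (∀ b : Fin m → A,
        F ((splitEquiv A l m).symm (a, b)) = (splitEquiv A l m).symm (a, F' b)) →
      Generates S ⟨m, F'⟩

/-- The gate class `⟨S⟩` generated by a set `S` of reversible gates. -/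
def genClosure {A : Type*} (S : Set (Gate A)) : Set (Gate A) := {g | Generates S g}

/-- A reversible gate class: a set of gates closed under the generation rules. -/
def IsGateClass {A : Type*} (S : Set (Gate A)) : Prop := ∀ g, Generates S g → g ∈ S

/-- The transposition gate `τ_{u,v}` exchanging the inputs `u` and `v`. -/
def tau {A : Type*} [DecidableEq A] {n : ℕ} (u v : Fin n → A) : GateFun A n :=
  Equiv.swap u v

/-- The controlled gate `w-F`, mapping `w u` to `w F(u)` and fixing all other inputs. -/
def controlled {A : Type*} [DecidableEq A] {l n : ℕ} (w : Fin l → A) (F : GateFun A n) :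
    GateFun A (l + n) :=
  ((splitEquiv A l n).trans
    (Equiv.prodCongrRight fun p => if p = w then F else Equiv.refl _)).trans
    (splitEquiv A l n).symm

/-- `SWAP_{a,b}` for single symbols `a`, `b`: exchanges `ab` and `ba`. -/
def swapGate {A : Type*} [DecidableEq A] (a b : A) : GateFun A 2 :=
  tau ![a, b] ![b, a]

/-- Number of occurrences of the symbol `a` in the string `x`. -/
def countOf {A : Type*} [DecidableEq A] {n : ℕ} (a : A) (x : Fin n → A) : ℕ :=
  (Finset.univ.filter fun i => x i = a).card

/-- Strings over `Fin k` correspond to strings over `Fin (k+1)` avoiding the new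
symbol `k+1` (the top element of `Fin (k+1)`). -/
def liftEquiv (k n : ℕ) : (Fin n → Fin k) ≃ {x : Fin n → Fin (k + 1) // ∀ i, (x i : ℕ) < k} where
  toFun u := ⟨fun i => (u i).castSucc, fun i => by simpa using (u i).isLt⟩
  invFun x := fun i => ⟨(x.1 i : ℕ), x.2 i⟩
  left_inv u := by funext i; apply Fin.ext; simp
  right_inv x := by
    apply Subtype.ext; funext i; apply Fin.ext; simp

/-- The gate `PF` over `{1,…,k+1}` induced by the gate `F` over `{1,…,k}`:
it fixes any input containing the new symbol `k+1` and acts as `F` otherwise. -/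
def pgate {k : ℕ} (g : Gate (Fin k)) : Gate (Fin (k + 1)) :=
  ⟨g.1, Equiv.Perm.extendDomain g.2 (liftEquiv k g.1)⟩

open Function Set

/-- The string over `Fin (k + 1)` carrying `x` on the positions `u` and the new symbol elsewhere. -/
noncomputable def padString {k : ℕ} {α β : Type*} (u : α ↪ β) (x : α → Fin k) :
    β → Fin (k + 1) :=
  extend u (fun i => (x i).castSucc) fun _ => Fin.last k

section padString

variable {k : ℕ} {α β γ : Type*}

@[simp] theorem padString_apply (u : α ↪ β) (x : α → Fin k) (i : α) :
    padString u x (u i) = (x i).castSucc :=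
  u.injective.extend_apply _ _ i

theorem padString_of_notMem {u : α ↪ β} (x : α → Fin k) {j : β} (hj : j ∉ range u) :
    padString u x j = Fin.last k :=
  extend_apply' _ _ _ hj

theorem padString_ne_last_iff (u : α ↪ β) (x : α → Fin k) (j : β) :
    padString u x j ≠ Fin.last k ↔ j ∈ range u := by
  refine ⟨fun h => by_contra fun hj => h (padString_of_notMem x hj), ?_⟩
  rintro ⟨i, rfl⟩
  simp

theorem padString_injective (u : α ↪ β) :
    Injective (padString u : (α → Fin k) → β → Fin (k + 1)) := by
  intro x y h
  funext i
  simpa using congrFun h (u i)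

theorem eq_padString (u : α ↪ β) (x : α → Fin k) (z : β → Fin (k + 1))
    (h : ∀ i, z (u i) = (x i).castSucc) (h' : ∀ j ∉ range u, z j = Fin.last k) :
    z = padString u x := by
  funext j
  by_cases hj : j ∈ range u
  · obtain ⟨i, rfl⟩ := hj
    simp [h]
  · rw [h' j hj, padString_of_notMem x hj]

theorem padString_comp_equiv (e : γ ≃ α) (u : α ↪ β) (v : γ ↪ β) (h : ∀ i, u (e i) = v i)
    (x : α → Fin k) : padString v (x ∘ e) = padString u x := by
  refine (eq_padString v _ _ (fun i => ?_) fun j hj => ?_).symm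
  · rw [← h, padString_apply, comp_apply]
  · refine padString_of_notMem x fun ⟨i, hi⟩ => hj ⟨e.symm i, ?_⟩
    rw [← h, e.apply_symm_apply, hi]

theorem exists_padString_eq {n : ℕ} (a : Fin n → Fin (k + 1)) :
    ∃ (q : ℕ) (u : Fin q ↪ Fin n) (x : Fin q → Fin k), padString u x = a := by
  classical
  let e := (Fintype.equivFin {i // a i ≠ Fin.last k}).symm
  refine ⟨_, e.toEmbedding.trans (Embedding.subtype _),
    fun i => (a (e i)).castPred (e i).2, (eq_padString _ _ _ (fun i => by simp) ?_).symm⟩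
  intro j hj
  by_contra h
  exact hj ⟨e.symm ⟨j, h⟩, by simp⟩

end padString

theorem exists_embedding_range_eq {n : ℕ} (s : Set (Fin n)) :
    ∃ (p : ℕ) (u : Fin p ↪ Fin n), range u = s := by
  classical
  refine ⟨_, (Fintype.equivFin s).symm.toEmbedding.trans (Embedding.subtype _), ?_⟩
  rw [Embedding.coe_trans, Equiv.coe_toEmbedding, EquivLike.range_comp]
  exact Subtype.range_coe

/-- The embedding of `Fin (p + q)` into `Fin (n + m)` acting blockwise. -/
def finAddEmbedding {p q n m : ℕ} (u : Fin p ↪ Fin n) (v : Fin q ↪ Fin m) :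
    Fin (p + q) ↪ Fin (n + m) :=
  finSumFinEquiv.symm.toEmbedding.trans ((u.sumMap v).trans finSumFinEquiv.toEmbedding)

section finAddEmbedding

variable {p q n m : ℕ} (u : Fin p ↪ Fin n) (v : Fin q ↪ Fin m)

@[simp] theorem finAddEmbedding_castAdd (i : Fin p) :
    finAddEmbedding u v (Fin.castAdd q i) = Fin.castAdd m (u i) := by
  simp [finAddEmbedding]

@[simp] theorem finAddEmbedding_natAdd (i : Fin q) :
    finAddEmbedding u v (Fin.natAdd p i) = Fin.natAdd n (v i) := by
  simp [finAddEmbedding]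

theorem castAdd_mem_range_finAddEmbedding (j : Fin n) :
    Fin.castAdd m j ∈ range (finAddEmbedding u v) ↔ j ∈ range u := by
  constructor
  · rintro ⟨i, hi⟩
    induction i using Fin.addCases with
    | left i => exact ⟨i, by simpa using hi⟩
    | right i =>
      have := congrArg Fin.val hi
      simp at this
      omega
  · rintro ⟨i, rfl⟩
    exact ⟨Fin.castAdd q i, by simp⟩

theorem natAdd_mem_range_finAddEmbedding (j : Fin m) :
    Fin.natAdd n j ∈ range (finAddEmbedding u v) ↔ j ∈ range v := by
  constructor
  · rintro ⟨i, hi⟩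
    induction i using Fin.addCases with
    | left i =>
      have := congrArg Fin.val hi
      simp at this
      omega
    | right i => exact ⟨i, by simpa using hi⟩
  · rintro ⟨i, rfl⟩
    exact ⟨Fin.natAdd p i, by simp⟩

theorem padString_finAddEmbedding {k : ℕ} (x : Fin p → Fin k) (y : Fin q → Fin k) :
    padString (finAddEmbedding u v) (Fin.append x y) =
      Fin.append (padString u x) (padString v y) := by
  refine (eq_padString _ _ _ (fun i => ?_) fun j hj => ?_).symm
  · induction i using Fin.addCases <;> simp
  · induction j using Fin.addCases with
    | left j =>
      rw [castAdd_mem_range_finAddEmbedding] at hj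
      simp [padString_of_notMem x hj]
    | right j =>
      rw [natAdd_mem_range_finAddEmbedding] at hj
      simp [padString_of_notMem y hj]

/-- An embedding into `Fin (n + m)` hitting exactly the range of `u` in the first block is, up to
reordering its domain, blockwise with first block `u`. -/
theorem exists_finAddEmbedding_eq {r : ℕ} (w : Fin r ↪ Fin (n + m))
    (h : ∀ j, Fin.castAdd m j ∈ range w ↔ j ∈ range u) :
    ∃ (q : ℕ) (v : Fin q ↪ Fin m) (e : Fin (p + q) ≃ Fin r),
      ∀ i, w (e i) = finAddEmbedding u v i := by
  obtain ⟨q, v, hv⟩ := exists_embedding_range_eq {j : Fin m | Fin.natAdd n j ∈ range w}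
  have hr : range (finAddEmbedding u v) = range w := by
    ext j
    induction j using Fin.addCases with
    | left j => rw [castAdd_mem_range_finAddEmbedding, h]
    | right j => rw [natAdd_mem_range_finAddEmbedding, hv, mem_ofPred_eq]
  refine ⟨q, v, ((Equiv.ofInjective _ (finAddEmbedding u v).injective).trans
    (Equiv.setCongr hr)).trans (Equiv.ofInjective _ w.injective).symm, fun i => ?_⟩
  simp [Equiv.apply_ofInjective_symm]

end finAddEmbedding

theorem splitEquiv_symm_apply {A : Type*} {n m : ℕ} (a : Fin n → A) (b : Fin m → A) :
    (splitEquiv A n m).symm (a, b) = Fin.append a b := by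
  funext i
  induction i using Fin.addCases <;> simp [splitEquiv, Equiv.sumArrowEquivProdArrow]

theorem tensorGate_append {A : Type*} {n m : ℕ} (F : GateFun A n) (G : GateFun A m)
    (a : Fin n → A) (b : Fin m → A) :
    tensorGate F G (Fin.append a b) = Fin.append (F a) (G b) := by
  rw [← splitEquiv_symm_apply, ← splitEquiv_symm_apply]
  simp [tensorGate]

theorem permGate_apply {A : Type*} {n : ℕ} (σ : Equiv.Perm (Fin n)) (x : Fin n → A) :
    permGate A σ x = x ∘ σ := by
  funext i
  simp [permGate]

theorem padString_refl {k : ℕ} {α : Type*} (y : α → Fin k) :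
    padString (Embedding.refl α) y = fun i => (y i).castSucc :=
  funext fun i => padString_apply (Embedding.refl α) y i

theorem pgate_padString_refl {k n : ℕ} (G : GateFun (Fin k) n) (y : Fin n → Fin k) :
    (pgate ⟨n, G⟩).2 (padString (Embedding.refl (Fin n)) y) =
      padString (Embedding.refl (Fin n)) (G y) := by
  refine (congrArg (pgate ⟨n, G⟩).2 (padString_refl y)).trans ?_
  exact (Equiv.Perm.extendDomain_apply_image G (liftEquiv k n) y).trans (padString_refl _).symm

/-- `g` moves the positions of the new symbol independently of the remaining entries, on which it
acts, for each set of such positions, by a gate of `S`. -/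
def ActsThrough {k : ℕ} (S : Set (Gate (Fin k))) (g : Gate (Fin (k + 1))) : Prop :=
  ∀ (p : ℕ) (u : Fin p ↪ Fin g.1), ∃ (v : Fin p ↪ Fin g.1) (G : GateFun (Fin k) p),
    (⟨p, G⟩ : Gate (Fin k)) ∈ S ∧ ∀ x, g.2 (padString u x) = padString v (G x)

section IsGateClass

variable {k : ℕ} {S : Set (Gate (Fin k))}

theorem IsGateClass.permGate_mem {A : Type*} {S : Set (Gate A)} (hS : IsGateClass S) {n : ℕ}
    (σ : Equiv.Perm (Fin n)) : (⟨n, permGate A σ⟩ : Gate A) ∈ S :=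
  hS _ (.perm n σ)

theorem IsGateClass.comp_mem {A : Type*} {S : Set (Gate A)} (hS : IsGateClass S) {n : ℕ}
    {F G : GateFun A n} (hF : (⟨n, F⟩ : Gate A) ∈ S) (hG : (⟨n, G⟩ : Gate A) ∈ S) :
    (⟨n, G.trans F⟩ : Gate A) ∈ S :=
  hS _ (.comp (.mem hF) (.mem hG))

theorem actsThrough_pgate (hS : IsGateClass S) {F : Gate (Fin k)} (hF : F ∈ S) :
    ActsThrough S (pgate F) := by
  obtain ⟨n, F⟩ := F
  intro p (u : Fin p ↪ Fin n)
  by_cases hu : Surjective u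
  · let e := Equiv.ofBijective u ⟨u.injective, hu⟩
    obtain rfl : p = n := by simpa using Fintype.card_congr e
    refine ⟨Embedding.refl _, _, hS.comp_mem hF (hS.permGate_mem e.symm), fun x => ?_⟩
    have hx : padString (Embedding.refl _) (x ∘ e.symm) = padString u x :=
      padString_comp_equiv _ _ _ (fun i => e.apply_symm_apply i) x
    refine ((congrArg (pgate ⟨_, F⟩).2 hx.symm).trans (pgate_padString_refl F _)).trans ?_
    exact congrArg (fun y => padString _ (F y)) (permGate_apply _ x).symm
  · refine ⟨u, _, hS.permGate_mem 1, fun x => ?_⟩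
    rw [permGate_apply]
    refine Equiv.Perm.extendDomain_apply_not_subtype _ _ fun h => hu fun j => ?_
    rw [← mem_range, ← padString_ne_last_iff u x]
    exact (Fin.lt_last_iff_ne_last).1 (h j)

theorem actsThrough_permGate (hS : IsGateClass S) {n : ℕ} (σ : Equiv.Perm (Fin n)) :
    ActsThrough S ⟨n, permGate _ σ⟩ := by
  intro p (u : Fin p ↪ Fin n)
  refine ⟨u.trans σ.symm.toEmbedding, _, hS.permGate_mem 1, fun x => ?_⟩
  rw [permGate_apply, permGate_apply]
  refine eq_padString _ _ _ (fun i => by simp) fun j hj => padString_of_notMem x ?_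
  rintro ⟨i, hi⟩
  exact hj ⟨i, by simp [hi]⟩

theorem ActsThrough.comp (hS : IsGateClass S) {n : ℕ} {F G : GateFun (Fin (k + 1)) n}
    (hF : ActsThrough S ⟨n, F⟩) (hG : ActsThrough S ⟨n, G⟩) :
    ActsThrough S ⟨n, G.trans F⟩ := by
  intro p u
  obtain ⟨v, G', hG', h⟩ := hG p u
  obtain ⟨w, F', hF', h'⟩ := hF p v
  exact ⟨w, _, hS.comp_mem hF' hG', fun x => (congrArg F (h x)).trans (h' _)⟩

theorem ActsThrough.tensor (hS : IsGateClass S) {n m : ℕ} {F : GateFun (Fin (k + 1)) n}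
    {G : GateFun (Fin (k + 1)) m} (hF : ActsThrough S ⟨n, F⟩) (hG : ActsThrough S ⟨m, G⟩) :
    ActsThrough S ⟨n + m, tensorGate F G⟩ := by
  intro r (w : Fin r ↪ Fin (n + m))
  obtain ⟨p, u₁, hu₁⟩ := exists_embedding_range_eq {j : Fin n | Fin.castAdd m j ∈ range w}
  obtain ⟨q, u₂, e, he⟩ := exists_finAddEmbedding_eq u₁ w fun j => by rw [hu₁, mem_ofPred_eq]
  obtain rfl : p + q = r := by simpa using Fintype.card_congr e
  obtain ⟨v₁, F', hF', h₁⟩ := hF p u₁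
  obtain ⟨v₂, G', hG', h₂⟩ := hG q u₂
  refine ⟨finAddEmbedding v₁ v₂, _, hS.comp_mem (hS _ (.tensor (.mem hF') (.mem hG')))
    (hS.permGate_mem e), fun x => ?_⟩
  obtain ⟨⟨y, z⟩, hyz⟩ := (splitEquiv (Fin k) p q).symm.surjective (x ∘ e)
  rw [splitEquiv_symm_apply] at hyz
  rw [Equiv.trans_apply, permGate_apply, ← padString_comp_equiv e w _ he x, ← hyz,
    padString_finAddEmbedding, tensorGate_append, tensorGate_append, padString_finAddEmbedding]
  exact congrArg₂ Fin.append (h₁ y) (h₂ z)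

theorem ActsThrough.ancilla [NeZero k] (hS : IsGateClass S) {l m : ℕ}
    {F : GateFun (Fin (k + 1)) (l + m)} (hF : ActsThrough S ⟨l + m, F⟩) (a : Fin l → Fin (k + 1))
    {F' : GateFun (Fin (k + 1)) m} (h : ∀ b, F (Fin.append a b) = Fin.append a (F' b)) :
    ActsThrough S ⟨m, F'⟩ := by
  intro p (u : Fin p ↪ Fin m)
  obtain ⟨q, ua, xa, rfl⟩ := exists_padString_eq a
  obtain ⟨w, G, hG, hw⟩ := hF _ (finAddEmbedding ua u)
  have key (x : Fin p → Fin k) : padString w (G (Fin.append xa x)) =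
      Fin.append (padString ua xa) (F' (padString u x)) := by
    rw [← hw, ← h, padString_finAddEmbedding]
  obtain ⟨p', v, e, he⟩ := exists_finAddEmbedding_eq ua w fun j => by
    rw [← padString_ne_last_iff w (G (Fin.append xa 0)), key, Fin.append_left,
      padString_ne_last_iff]
  obtain rfl : p' = p := by simpa using Fintype.card_congr e
  let G' : GateFun (Fin k) (q + p') := G.trans (permGate _ e)
  have hG' : (⟨q + p', G'⟩ : Gate (Fin k)) ∈ S := hS.comp_mem (hS.permGate_mem e) hG
  have key' (x : Fin p' → Fin k) : ∃ y, G' (Fin.append xa x) = Fin.append xa y ∧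
      F' (padString u x) = padString v y := by
    obtain ⟨⟨z, y⟩, hzy⟩ := (splitEquiv (Fin k) q p').symm.surjective (G' (Fin.append xa x))
    rw [splitEquiv_symm_apply] at hzy
    have hx := key x
    rw [← padString_comp_equiv e w _ he, ← permGate_apply] at hx
    change padString _ (G' _) = _ at hx
    rw [← hzy, padString_finAddEmbedding] at hx
    obtain rfl : z = xa := padString_injective ua <| funext fun i => by
      simpa using congrFun hx (Fin.castAdd m i)
    exact ⟨y, hzy.symm, funext fun i => by simpa using (congrFun hx (Fin.natAdd l i)).symm⟩
  choose H hH hH' using key'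
  have hinj : Injective H := fun x y hxy => padString_injective u <| F'.injective <| by
    rw [hH', hH', hxy]
  refine ⟨v, Equiv.ofBijective H (Finite.injective_iff_bijective.1 hinj), ?_, hH'⟩
  refine hS _ (.ancilla xa (.mem hG') fun x => ?_)
  rw [splitEquiv_symm_apply, splitEquiv_symm_apply, hH, Equiv.ofBijective_apply]

theorem actsThrough_of_generates [NeZero k] (hS : IsGateClass S) {g : Gate (Fin (k + 1))}
    (hg : Generates (pgate '' S) g) : ActsThrough S g := by
  induction hg with
  | mem h =>
    obtain ⟨F, hF, rfl⟩ := h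
    exact actsThrough_pgate hS hF
  | perm n σ => exact actsThrough_permGate hS σ
  | tensor _ _ hF hG => exact hF.tensor hS hG
  | comp _ _ hF hG => exact hF.comp hS hG
  | ancilla a _ h hF => exact hF.ancilla hS a fun b => by simpa only [splitEquiv_symm_apply] using h b

end IsGateClass

/-- For any reversible gate `F` over `A = {1,…,k}` (`k ≥ 2`) and any gate class `S`
over `A`: if `PF ∈ PS = ⟨PG : G ∈ S⟩` then `F ∈ S`. -/
theorem pgate_mem_imp_mem (k : ℕ) (hk : 2 ≤ k)
    (S : Set (Gate (Fin k))) (hS : IsGateClass S)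
    (F : Gate (Fin k)) (h : pgate F ∈ genClosure (pgate '' S)) :
    F ∈ S := by
  have : NeZero k := ⟨by omega⟩
  obtain ⟨n, F⟩ := F
  obtain ⟨v, G, hG, hFG⟩ := actsThrough_of_generates hS h n (Embedding.refl (Fin n))
  change Fin n ↪ Fin n at v
  let e := Equiv.ofBijective v (Finite.injective_iff_bijective.1 v.injective)
  have hF : G.trans (permGate _ e.symm) = F := by
    ext1 x
    refine padString_injective (Embedding.refl (Fin n)) ?_
    rw [Equiv.trans_apply, permGate_apply,
      padString_comp_equiv e.symm v (Embedding.refl _) (fun i => e.apply_symm_apply i)]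
    exact (hFG x).symm.trans (pgate_padString_refl F x)
  exact hF ▸ hS.comp_mem (hS.permGate_mem e.symm) hG
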